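/- Let (C, (F_i)_{i∈I}) be a finitely connected Galois category whose terminal object is connected. Then each F_i reflects isomorphisms: if u is a morphism of C such that F_i.map u is a bijection, then u is an isomorphism. Consequently C is a (connected) Galois category with fiber functor F_i for each i ∈ I. -/

import Mathlib

open CategoryTheory Limits PreGaloisCategory

universe u v w

section FintypeValuedFunctor

variable {C : Type u} [Category.{v} C] (F : C ⥤ FintypeCat.{v})

lemma isIso_map_iff_bijective {X Y : C} (f : X ⟶ Y) :
    IsIso (F.map f) ↔ Function.Bijective (F.map f) :=
  ConcreteCategory.isIso_iff_bijective (F.map f)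

lemma isEmpty_obj_of_isInitial [PreservesFiniteColimits F] {X : C} (h : IsInitial X) :
    IsEmpty (F.obj X) :=
  (Types.initial_iff_empty ((F ⋙ FintypeCat.incl).obj X)).mp ⟨h.isInitialObj _ _⟩

lemma surjective_map_of_epi [PreservesFiniteColimits F] {X Y : C} (f : X ⟶ Y) [Epi f] :
    Function.Surjective (F.map f) :=
  surjective_of_epi (FintypeCat.incl.map (F.map f))

lemma exists_obj_prod [PreservesFiniteLimits F] {X Y : C} [HasBinaryProduct X Y]
    (x : F.obj X) (y : F.obj Y) :
    ∃ p : F.obj (X ⨯ Y), F.map prod.fst p = x ∧ F.map prod.snd p = y := by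
  let e := PreservesLimitPair.iso (F ⋙ FintypeCat.incl) X Y ≪≫
    Types.binaryProductIso (F.obj X) (F.obj Y)
  refine ⟨e.inv (x, y), ?_, ?_⟩
  · change (e.inv ≫ (F ⋙ FintypeCat.incl).map prod.fst) (x, y) = x
    simp only [e, Iso.trans_inv, Category.assoc]
    erw [PreservesLimitPair.iso_inv_fst, Types.binaryProductIso_inv_comp_fst]
    rfl
  · change (e.inv ≫ (F ⋙ FintypeCat.incl).map prod.snd) (x, y) = y
    simp only [e, Iso.trans_inv, Category.assoc]
    erw [PreservesLimitPair.iso_inv_snd, Types.binaryProductIso_inv_comp_snd]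
    rfl

lemma isIso_map_pullback_fst [PreservesFiniteLimits F] {X Y : C} (f : X ⟶ Y) [HasPullback f f]
    (hf : Function.Injective (F.map f)) : IsIso (F.map (pullback.fst f f)) := by
  have : Mono (F.map f) := ConcreteCategory.mono_of_injective _ hf
  have : IsIso (pullback.fst (F.map f) (F.map f)) := isIso_fst_of_mono (F.map f)
  rw [← PreservesPullback.iso_hom_fst]
  exact IsIso.comp_isIso

/-- The coequalizer of the two projections of `X ⨯ X` has at most one point in each fiber. -/
lemma subsingleton_obj_coequalizer [PreservesFiniteLimits F] [PreservesFiniteColimits F]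
    (X : C) [HasBinaryProduct X X]
    [HasCoequalizer (prod.fst : X ⨯ X ⟶ X) prod.snd] :
    Subsingleton (F.obj (coequalizer (prod.fst : X ⨯ X ⟶ X) prod.snd)) := by
  refine ⟨fun a b ↦ ?_⟩
  obtain ⟨x, rfl⟩ := surjective_map_of_epi F (coequalizer.π (prod.fst : X ⨯ X ⟶ X) prod.snd) a
  obtain ⟨y, rfl⟩ := surjective_map_of_epi F (coequalizer.π (prod.fst : X ⨯ X ⟶ X) prod.snd) b
  obtain ⟨p, rfl, rfl⟩ := exists_obj_prod F x y
  simpa using ConcreteCategory.congr_hom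
    (F.congr_map (coequalizer.condition (prod.fst : X ⨯ X ⟶ X) prod.snd)) p

lemma isCompl_range_map_of_isColimit [PreservesFiniteColimits F] {X Y Z : C} {i : X ⟶ Y}
    {j : Z ⟶ Y} (h : IsColimit (BinaryCofan.mk i j)) :
    IsCompl (Set.range (F.map i)) (Set.range (F.map j)) :=
  ((Types.binaryCofan_isColimit_iff _).mp
    ⟨mapIsColimitOfPreservesOfIsColimit (F ⋙ FintypeCat.incl) i j h⟩).2.2

end FintypeValuedFunctor

section ConservativeFamily

variable {C : Type u} [Category.{v} C] [PreGaloisCategory C] {I : Type w}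
  {F : I → C ⥤ FintypeCat.{v}} [∀ i, PreservesFiniteLimits (F i)]

lemma mono_of_forall_injective_map
    (hiso : ∀ {A B : C} (u : A ⟶ B), IsIso u ↔ ∀ i, Function.Bijective ((F i).map u))
    {X Y : C} (f : X ⟶ Y) (hf : ∀ i, Function.Injective ((F i).map f)) : Mono f := by
  have : IsIso (pullback.fst f f) := (hiso _).mpr fun i ↦
    (isIso_map_iff_bijective (F i) _).mp (isIso_map_pullback_fst (F i) f (hf i))
  exact (pullback.diagonal_isKernelPair f).mono_of_isIso_fst

variable [∀ i, PreservesFiniteColimits (F i)]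

lemma isEmpty_obj_of_isEmpty_obj [HasFiniteColimits C]
    (hiso : ∀ {A B : C} (u : A ⟶ B), IsIso u ↔ ∀ i, Function.Bijective ((F i).map u))
    {t : C} (ht : IsTerminal t) (hconn : PreGaloisCategory.IsConnected t) {i : I} {X : C}
    (hX : IsEmpty ((F i).obj X)) (j : I) : IsEmpty ((F j).obj X) := by
  let q := coequalizer.π (prod.fst : X ⨯ X ⟶ X) prod.snd
  have hsub (k : I) := subsingleton_obj_coequalizer (F k) X
  have hmono := mono_of_forall_injective_map hiso
    (ht.from (coequalizer (prod.fst : X ⨯ X ⟶ X) prod.snd))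
    fun k ↦ Function.injective_of_subsingleton _
  by_cases h : Nonempty (IsInitial (coequalizer (prod.fst : X ⨯ X ⟶ X) prod.snd))
  · have := isEmpty_obj_of_isInitial (F j) h.some
    exact Function.isEmpty ((F j).map q)
  · exfalso
    have hq := hconn.noTrivialComponent _ (ht.from _) fun h' ↦ h ⟨h'⟩
    have hempty : IsEmpty ((F i).obj t) := by
      refine ⟨fun x ↦ ?_⟩
      obtain ⟨y, -⟩ := ((hiso _).mp hq i).surjective x
      obtain ⟨z, -⟩ := surjective_map_of_epi (F i) q y
      exact hX.false z
    exact hempty.false ((Types.isTerminalEquivUnique _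
      (ht.isTerminalObj ((F i) ⋙ FintypeCat.incl) t)).default)

lemma isIso_of_mono_of_surjective_map [HasFiniteColimits C]
    (hiso : ∀ {A B : C} (u : A ⟶ B), IsIso u ↔ ∀ i, Function.Bijective ((F i).map u))
    {t : C} (ht : IsTerminal t) (hconn : PreGaloisCategory.IsConnected t) {i : I}
    {X Y : C} (f : X ⟶ Y) [Mono f] (hf : Function.Surjective ((F i).map f)) : IsIso f := by
  obtain ⟨Z, g, ⟨hc⟩⟩ := monoInducesIsoOnDirectSummand f
  have hZ : IsEmpty ((F i).obj Z) := by
    have h := (isCompl_range_map_of_isColimit (F i) hc).disjoint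
    rw [hf.range_eq] at h
    exact Set.range_eq_empty_iff.mp (top_disjoint.mp h)
  refine (hiso f).mpr fun j ↦
    ⟨ConcreteCategory.injective_of_mono_of_preservesPullback ((F j).map f), ?_⟩
  have := isEmpty_obj_of_isEmpty_obj hiso ht hconn hZ j
  have h := (isCompl_range_map_of_isColimit (F j) hc).codisjoint
  rw [Set.range_eq_empty ((F j).map g)] at h
  exact Set.range_eq_univ.mp (codisjoint_bot.mp h)

lemma isIso_of_bijective_map [HasFiniteColimits C]
    (hiso : ∀ {A B : C} (u : A ⟶ B), IsIso u ↔ ∀ i, Function.Bijective ((F i).map u))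
    {t : C} (ht : IsTerminal t) (hconn : PreGaloisCategory.IsConnected t) {i : I}
    {X Y : C} (f : X ⟶ Y) (hf : Function.Bijective ((F i).map f)) : IsIso f := by
  have hfst := isIso_map_pullback_fst (F i) f hf.injective
  have : IsIso ((F i).map (pullback.diagonal f) ≫ (F i).map (pullback.fst f f)) := by
    rw [← Functor.map_comp, pullback.diagonal_fst]
    infer_instance
  have hdiag : IsIso ((F i).map (pullback.diagonal f)) :=
    IsIso.of_isIso_comp_right _ ((F i).map (pullback.fst f f))
  have : IsIso (pullback.diagonal f) := isIso_of_mono_of_surjective_map hiso ht hconn _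
    ((isIso_map_iff_bijective (F i) _).mp hdiag).surjective
  have : Mono f := (pullback.isIso_diagonal_iff f).mp this
  exact isIso_of_mono_of_surjective_map hiso ht hconn f hf.surjective

end ConservativeFamily

/-- Let `(C, (F i)_{i ∈ I})` be a finitely connected Galois category whose
terminal object is connected. Then each `F i` reflects isomorphisms (if `(F i).map u` is
bijective then `u` is an isomorphism), and consequently `C` is a (connected) Galois category
with fiber functor `F i` for each `i ∈ I`. -/
theorem fiberFunctor_of_connected_terminal
    {C : Type u} [Category.{v} C] [PreGaloisCategory C] [HasFiniteColimits C]
    {I : Type w} [Finite I] [Nonempty I] (F : I → C ⥤ FintypeCat.{v})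
    [∀ i, PreservesFiniteLimits (F i)] [∀ i, PreservesFiniteColimits (F i)]
    (hiso : ∀ {A B : C} (u : A ⟶ B), IsIso u ↔ ∀ i, Function.Bijective ((F i).map u))
    (t : C) (ht : IsTerminal t) (hconn : IsConnected t) (i : I) :
    (∀ {A B : C} (u : A ⟶ B), Function.Bijective ((F i).map u) → IsIso u) ∧
      Nonempty (FiberFunctor (F i)) := by
  have h : ∀ {A B : C} (u : A ⟶ B), Function.Bijective ((F i).map u) → IsIso u :=
    fun u ↦ isIso_of_bijective_map hiso ht hconn u
  have : (F i).ReflectsIsomorphisms :=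
    ⟨fun u _ ↦ h u ((isIso_map_iff_bijective (F i) u).mp inferInstance)⟩
  refine ⟨h, ⟨{ preservesQuotientsByFiniteGroups := fun G _ _ ↦ ?_ }⟩⟩
  obtain ⟨G', _, _, ⟨e⟩⟩ := Finite.exists_type_univ_nonempty_mulEquiv.{v, 0} G
  exact preservesColimitsOfShape_of_equiv e.toSingleObjEquiv.symm (F i)
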